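/- Let G be a connected loopless weighted graph (q_e ≠ 0 for every edge e). Then dim_K Ψ^{In}_{G,Q} equals the number of distinct strongly-connected score vectors, i.e., the cardinality of { D ∈ K^n : there exists a strongly connected orientation o of G with D = D_o }. -/

import Mathlib

open MvPolynomial

set_option synthInstance.maxHeartbeats 1000000
set_option maxHeartbeats 1000000

noncomputable section

/-- The head of edge `e` under orientation `o`. -/
def head {n : ℕ} {E : Type*} (a b : E → Fin n) (o : E → Bool) (e : E) : Fin n :=
  if o e then a e else b e

/-- The tail of edge `e` under orientation `o`. -/
def tail {n : ℕ} {E : Type*} (a b : E → Fin n) (o : E → Bool) (e : E) : Fin n :=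
  if o e then b e else a e

/-- The score vector of an orientation. -/
def score (K : Type*) [Field K] {n : ℕ} {E : Type*} [Fintype E]
    (a b : E → Fin n) (q : E → K) (o : E → Bool) (i : Fin n) : K :=
  ∑ e ∈ Finset.univ.filter fun e => head a b o e = i, q e

/-- The edges of the cut oriented out of `I` (small endpoint in `I`). -/
def cutOut {n : ℕ} {E : Type*} [Fintype E] (a b : E → Fin n) (I : Finset (Fin n)) :
    Finset E :=
  Finset.univ.filter fun e => a e ∈ I ∧ b e ∉ I

/-- The edges of the cut oriented into `I` (large endpoint in `I`). -/
def cutIn {n : ℕ} {E : Type*} [Fintype E] (a b : E → Fin n) (I : Finset (Fin n)) :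
    Finset E :=
  Finset.univ.filter fun e => b e ∈ I ∧ a e ∉ I

/-- The cut polynomial `f_I`. -/
def fI {K : Type*} [Field K] {n : ℕ} {E : Type*} [Fintype E]
    (a b : E → Fin n) (q : E → K) (I : Finset (Fin n)) : MvPolynomial E K :=
  (∏ e ∈ cutOut a b I, X e) * ∏ e ∈ cutIn a b I, (X e - C (q e))

/-- The graph `G` is connected. -/
def IsConnectedGraph {n : ℕ} {E : Type*} (a b : E → Fin n) : Prop :=
  ∀ x y : Fin n,
    Relation.ReflTransGen (fun u w => ∃ e, (a e = u ∧ b e = w) ∨ (a e = w ∧ b e = u)) x y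

/-- The ideal of relations of `Φ^{In}_{G,Q}`: the relations `u_e^2 = q_e u_e` together with
the cut relations `f_I = 0` for all proper nonempty subsets `I`. -/
def relIdealIn (K : Type*) [Field K] {n : ℕ} (E : Type*) [Fintype E]
    (a b : E → Fin n) (q : E → K) : Ideal (MvPolynomial E K) :=
  Ideal.span ((Set.range fun e : E => (X e) ^ 2 - C (q e) * X e) ∪
    {p | ∃ I : Finset (Fin n), I.Nonempty ∧ I ≠ Finset.univ ∧ p = fI a b q I})

/-- The algebra `Φ^{In}_{G,Q}`. -/
abbrev PhiIn (K : Type*) [Field K] {n : ℕ} (E : Type*) [Fintype E]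
    (a b : E → Fin n) (q : E → K) : Type _ :=
  MvPolynomial E K ⧸ relIdealIn K E a b q

/-- The generator `X_i^{In}`. -/
def XIn (K : Type*) [Field K] {n : ℕ} {E : Type*} [Fintype E]
    (a b : E → Fin n) (q : E → K) (i : Fin n) : PhiIn K E a b q :=
  Ideal.Quotient.mk _
    ((∑ e ∈ Finset.univ.filter fun e => a e = i, X e) -
      ∑ e ∈ Finset.univ.filter fun e => b e = i, X e)

/-- The `Q`-deformation `Ψ^{In}_{G,Q}` of the internal algebra. -/
def PsiIn (K : Type*) [Field K] {n : ℕ} {E : Type*} [Fintype E]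
    (a b : E → Fin n) (q : E → K) : Subalgebra K (PhiIn K E a b q) :=
  Algebra.adjoin K (Set.range (XIn K a b q))


/-- Value of the variable `u_e` at the point associated to an orientation. -/
def ptOf {K : Type*} [Field K] {E : Type*} (q : E → K) (o : E → Bool) (e : E) : K :=
  if o e then q e else 0

/-- The idempotent of an orientation. -/
def idem {K : Type*} [Field K] {E : Type*} [Fintype E] (q : E → K) (o : E → Bool) :
    MvPolynomial E K :=
  ∏ e, (if o e then C (q e)⁻¹ * X e else 1 - C (q e)⁻¹ * X e)

/-- Strong connectivity. -/
def IsStrong {n : ℕ} {E : Type*} (a b : E → Fin n) (o : E → Bool) : Prop :=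
  ∀ u v : Fin n, Relation.ReflTransGen
          (fun x y => ∃ e, tail a b o e = x ∧ head a b o e = y) u v

theorem sum_idem {K : Type*} [Field K] {E : Type*} [Fintype E] [DecidableEq E] (q : E → K) :
    ∑ o : E → Bool, idem q o = 1 := by
  unfold idem
  have h := Finset.prod_univ_sum (fun _ : E => (Finset.univ : Finset Bool))
    (fun e (x : Bool) => (if x then C (q e)⁻¹ * X e else 1 - C (q e)⁻¹ * X e : MvPolynomial E K))
  rw [Fintype.piFinset_univ] at h
  rw [← h]
  simp

theorem X_mul_idem {K : Type*} [Field K] {E : Type*} [Fintype E] [DecidableEq E]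
    (q : E → K) (hq : ∀ e, q e ≠ 0) (J : Ideal (MvPolynomial E K))
    (hJ : ∀ e, (X e) ^ 2 - C (q e) * X e ∈ J) (o : E → Bool) (e : E) :
    (X e - C (ptOf q o e)) * idem q o ∈ J := by
  unfold idem
  rw [← Finset.mul_prod_erase _ _ (Finset.mem_univ e), ← mul_assoc]
  apply J.mul_mem_right
  have hc : (C (q e)⁻¹ * C (q e) : MvPolynomial E K) = 1 := by
    rw [← C_mul, inv_mul_cancel₀ (hq e), C_1]
  unfold ptOf
  cases o e
  · have : (X e - C (0 : K)) * (1 - C (q e)⁻¹ * X e)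
        = (- C (q e)⁻¹) * ((X e) ^ 2 - C (q e) * X e) := by
      rw [C_0]; linear_combination (-(X e : MvPolynomial E K)) * hc
    have h := J.mul_mem_left (- C (q e)⁻¹) (hJ e)
    rw [← this] at h
    simpa using h
  · have : (X e - C (q e)) * (C (q e)⁻¹ * X e)
        = (C (q e)⁻¹) * ((X e) ^ 2 - C (q e) * X e) := by
      ring
    simpa [this] using J.mul_mem_left (C (q e)⁻¹) (hJ e)

theorem poly_mul_idem {K : Type*} [Field K] {E : Type*} [Fintype E] [DecidableEq E]
    (q : E → K) (hq : ∀ e, q e ≠ 0) (J : Ideal (MvPolynomial E K))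
    (hJ : ∀ e, (X e) ^ 2 - C (q e) * X e ∈ J) (o : E → Bool) (p : MvPolynomial E K) :
    (p - C (eval (ptOf q o) p)) * idem q o ∈ J := by
  induction p using MvPolynomial.induction_on with
  | C r => simp
  | add p r hp hr =>
    have := J.add_mem hp hr
    convert this using 1
    simp only [map_add]; ring
  | mul_X p e hp =>
    have := J.add_mem (J.mul_mem_left (X e) hp)
      (J.mul_mem_left (C (eval (ptOf q o) p)) (X_mul_idem q hq J hJ o e))
    convert this using 1
    simp only [map_mul, eval_X]; ring

theorem eval_fI_ne {K : Type*} [Field K] {n : ℕ} {E : Type*} [Fintype E]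
    (a b : E → Fin n) (q : E → K) (hq : ∀ e, q e ≠ 0) (o : E → Bool) (I : Finset (Fin n)) :
    eval (ptOf q o) (fI a b q I) ≠ 0 ↔
      ∀ e, tail a b o e ∈ I → head a b o e ∈ I := by
  simp only [fI, map_mul, map_prod, map_sub, eval_X, eval_C, mul_ne_zero_iff, Finset.prod_ne_zero_iff,
    cutOut, cutIn, Finset.mem_filter, Finset.mem_univ, true_and, ptOf, tail, head]
  constructor
  · rintro ⟨h1, h2⟩ e
    have h1 := h1 e
    have h2 := h2 e
    cases h : o e <;> simp [h] at h1 h2 ⊢ <;> tauto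
  · intro h0
    refine ⟨fun e he => ?_, fun e he => ?_⟩ <;> have h0 := h0 e <;>
      cases h : o e <;> simp [h, hq e] at h0 ⊢ <;> tauto

theorem strong_of {n : ℕ} {E : Type*} (a b : E → Fin n) (o : E → Bool)
    (h : ¬ IsStrong a b o) : ∃ I : Finset (Fin n), I.Nonempty ∧ I ≠ Finset.univ ∧
      ∀ e, tail a b o e ∈ I → head a b o e ∈ I := by
  classical
  unfold IsStrong at h
  push Not at h
  obtain ⟨u, v, huv⟩ := h
  refine ⟨Finset.univ.filter fun w => Relation.ReflTransGen
          (fun x y => ∃ e, tail a b o e = x ∧ head a b o e = y) u w, ⟨u, ?_⟩, ?_, ?_⟩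
  · simp [Relation.ReflTransGen.refl]
  · intro hI
    have := Finset.mem_univ v
    rw [← hI] at this
    simp at this
    exact huv this
  · intro e he
    simp only [Finset.mem_filter, Finset.mem_univ, true_and] at he ⊢
    exact he.tail ⟨e, rfl, rfl⟩

theorem not_strong_of {n : ℕ} {E : Type*} (a b : E → Fin n) (o : E → Bool)
    (I : Finset (Fin n)) (hI : I.Nonempty) (hI' : I ≠ Finset.univ)
    (h : ∀ e, tail a b o e ∈ I → head a b o e ∈ I) : ¬ IsStrong a b o := by
  intro hs
  obtain ⟨u, hu⟩ := hI
  apply hI'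
  ext v
  simp only [Finset.mem_univ, iff_true]
  have := hs u v
  induction this with
  | refl => exact hu
  | tail _ hst ih =>
    obtain ⟨e, rfl, rfl⟩ := hst
    exact h e ih

/-- Evaluation at all strongly connected orientations. -/
def evS {K : Type*} [Field K] {n : ℕ} {E : Type*} (a b : E → Fin n) (q : E → K) :
    MvPolynomial E K →ₐ[K] ({o : E → Bool // IsStrong a b o} → K) :=
  AlgHom.pi fun o => aeval (ptOf q o.1)

theorem evS_apply {K : Type*} [Field K] {n : ℕ} {E : Type*} (a b : E → Fin n) (q : E → K)
    (p : MvPolynomial E K) (o : {o : E → Bool // IsStrong a b o}) :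
    evS a b q p o = eval (ptOf q o.1) p := by
  simp [evS, aeval_eq_eval]

theorem mem_rel_iff {K : Type*} [Field K] {n : ℕ} {E : Type*} [Fintype E] [DecidableEq E]
    (a b : E → Fin n) (q : E → K) (hq : ∀ e, q e ≠ 0) (p : MvPolynomial E K) :
    p ∈ relIdealIn K E a b q ↔ evS a b q p = 0 := by
  constructor
  · intro hp
    have : relIdealIn K E a b q ≤ RingHom.ker (evS a b q) := by
      unfold relIdealIn
      rw [Ideal.span_le]
      rintro r (⟨e, rfl⟩ | ⟨I, hI, hI', rfl⟩)
      · simp only [SetLike.mem_coe, RingHom.mem_ker]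
        funext o
        rw [evS_apply]
        simp only [map_sub, map_pow, map_mul, eval_X, eval_C, ptOf, Pi.zero_apply]
        split_ifs <;> ring
      · simp only [SetLike.mem_coe, RingHom.mem_ker]
        funext o
        rw [evS_apply]
        by_contra hne
        exact not_strong_of a b o.1 I hI hI' ((eval_fI_ne a b q hq o.1 I).1 hne) o.2
    exact this hp
  · intro hp
    have hJ : ∀ e, (X e) ^ 2 - C (q e) * X e ∈ relIdealIn K E a b q :=
      fun e => Ideal.subset_span (Or.inl ⟨e, rfl⟩)
    have : p = ∑ o : E → Bool, p * idem q o := by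
      rw [← Finset.mul_sum, sum_idem, mul_one]
    rw [this]
    refine Ideal.sum_mem _ fun o _ => ?_
    by_cases ho : IsStrong a b o
    · have h1 := poly_mul_idem q hq _ hJ o p
      have h2 := congrFun hp ⟨o, ho⟩
      rw [evS_apply] at h2
      simp only [Pi.zero_apply] at h2
      simpa [h2] using h1
    · obtain ⟨I, hI, hI', hcl⟩ := strong_of a b o ho
      have hne := (eval_fI_ne a b q hq o I).2 hcl
      have hf : fI a b q I ∈ relIdealIn K E a b q :=
        Ideal.subset_span (Or.inr ⟨I, hI, hI', rfl⟩)
      have h1 := poly_mul_idem q hq _ hJ o (fI a b q I)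
      have h3 := Ideal.sub_mem _ (Ideal.mul_mem_right (idem q o) _ hf) h1
      have h4 := Ideal.mul_mem_left _ (p * C (eval (ptOf q o) (fI a b q I))⁻¹) h3
      convert h4 using 1
      have hc : (C (eval (ptOf q o) (fI a b q I))⁻¹ * C (eval (ptOf q o) (fI a b q I)) :
          MvPolynomial E K) = 1 := by
        rw [← C_mul, inv_mul_cancel₀ hne, C_1]
      linear_combination (-p * idem q o) * hc

/-- The evaluation on the quotient. -/
def evPhi {K : Type*} [Field K] {n : ℕ} {E : Type*} [Fintype E] [DecidableEq E]
    (a b : E → Fin n) (q : E → K) (hq : ∀ e, q e ≠ 0) :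
    PhiIn K E a b q →ₐ[K] ({o : E → Bool // IsStrong a b o} → K) :=
  Ideal.Quotient.liftₐ _ (evS a b q) fun p hp => (mem_rel_iff a b q hq p).1 hp

theorem evPhi_inj {K : Type*} [Field K] {n : ℕ} {E : Type*} [Fintype E] [DecidableEq E]
    (a b : E → Fin n) (q : E → K) (hq : ∀ e, q e ≠ 0) :
    Function.Injective (evPhi a b q hq) := by
  rw [injective_iff_map_eq_zero]
  intro x hx
  obtain ⟨p, rfl⟩ := Ideal.Quotient.mk_surjective x
  rw [Ideal.Quotient.eq_zero_iff_mem, mem_rel_iff a b q hq]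
  exact hx

theorem evPhi_XIn {K : Type*} [Field K] {n : ℕ} {E : Type*} [Fintype E] [DecidableEq E]
    (a b : E → Fin n) (q : E → K) (hab : ∀ e, a e < b e) (hq : ∀ e, q e ≠ 0) (i : Fin n)
    (o : {o : E → Bool // IsStrong a b o}) :
    evPhi a b q hq (XIn K a b q i) o =
      score K a b q o.1 i - ∑ e ∈ Finset.univ.filter (fun e => b e = i), q e := by
  have : evPhi a b q hq (XIn K a b q i) o = evS a b q
    ((∑ e ∈ Finset.univ.filter fun e => a e = i, X e) -
      ∑ e ∈ Finset.univ.filter fun e => b e = i, X e) o := rfl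
  rw [this, evS_apply]
  simp only [map_sub, map_sum, eval_X, score, Finset.sum_filter, ← Finset.sum_sub_distrib]
  refine Finset.sum_congr rfl fun e _ => ?_
  have hlt := hab e
  unfold head
  cases ho : o.1 e <;> by_cases h1 : a e = i <;> by_cases h2 : b e = i <;>
  first
  | (exfalso; rw [h1, h2] at hlt; exact lt_irrefl _ hlt)
  | simp [h1, h2, ho, ptOf]

/-- A subalgebra of functions generated by finitely many coordinates. -/
theorem finrank_adjoin_coords {K : Type*} [Field K] {S : Type*} [Finite S] {n : ℕ}
    (f : S → Fin n → K) (c : Fin n → K) :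
    Module.finrank K (Algebra.adjoin K (Set.range fun (i : Fin n) (s : S) => f s i - c i)) =
      (Set.range f).ncard := by
  classical
  have : Fintype (Set.range f) := Fintype.ofFinite _
  set A := Algebra.adjoin K (Set.range fun (i : Fin n) (s : S) => f s i - c i) with hA
  let g : (Set.range f → K) →ₐ[K] (S → K) :=
    AlgHom.pi fun s => Pi.evalAlgHom K (fun _ : Set.range f => K) ⟨f s, s, rfl⟩
  have hg : ∀ x s, g x s = x ⟨f s, s, rfl⟩ := fun x s => rfl
  have ginj : Function.Injective g := by
    intro x y hxy
    funext ⟨_, s, rfl⟩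
    exact congrFun hxy s
  have hcoord : ∀ (i : Fin n) (t r : K), (fun s => r * (f s i - t)) ∈ A := by
    intro i t r
    have h1 : (fun s => f s i - c i) ∈ A := Algebra.subset_adjoin ⟨i, rfl⟩
    have h2 := A.smul_mem (A.add_mem h1 (A.algebraMap_mem (c i - t))) r
    convert h2 using 1
    funext s
    simp
  have hsingle : ∀ D : Set.range f, g (Pi.single D 1) ∈ A := by
    intro D
    have key : ∀ D' : Set.range f, ∃ h ∈ A, D' ≠ D → ∀ s, (f s = D.1 → h s = 1) ∧
        (f s = D'.1 → h s = 0) := by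
      intro D'
      by_cases hD : D' = D
      · exact ⟨0, A.zero_mem, fun h => absurd hD h⟩
      · have : ∃ i, D.1 i ≠ D'.1 i := by
          by_contra hcon
          push Not at hcon
          exact hD (Subtype.ext (funext fun i => (hcon i).symm))
        obtain ⟨i, hi⟩ := this
        refine ⟨_, hcoord i (D'.1 i) (D.1 i - D'.1 i)⁻¹, fun _ s => ⟨fun h => ?_, fun h => ?_⟩⟩
        · simp only [h]
          exact inv_mul_cancel₀ (sub_ne_zero.2 hi)
        · simp only [h, sub_self, mul_zero]
    choose h hmem hh using key
    have : g (Pi.single D 1) = ∏ D' ∈ Finset.univ.erase D, h D' := by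
      funext s
      rw [hg, Finset.prod_apply]
      by_cases hs : f s = D.1
      · have hs' : (⟨f s, s, rfl⟩ : Set.range f) = D := Subtype.ext hs
        rw [hs', Pi.single_eq_same, Finset.prod_eq_one]
        intro D' hD'
        exact (hh D' (Finset.ne_of_mem_erase hD') s).1 hs
      · have hs' : (⟨f s, s, rfl⟩ : Set.range f) ≠ D := fun h => hs (congrArg Subtype.val h)
        rw [Pi.single_eq_of_ne hs']
        exact (Finset.prod_eq_zero (Finset.mem_erase.2 ⟨hs', Finset.mem_univ _⟩)
          ((hh _ hs' s).2 rfl)).symm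
    rw [this]
    exact A.prod_mem fun D' _ => hmem D'
  have hAg : A = g.range := by
    apply le_antisymm
    · rw [hA, Algebra.adjoin_le_iff]
      rintro _ ⟨i, rfl⟩
      exact ⟨fun D => D.1 i - c i, rfl⟩
    · rintro _ ⟨x, rfl⟩
      have hx : x = ∑ D, x D • (Pi.single D 1 : Set.range f → K) := by
        funext D
        simp [Finset.sum_apply, Pi.single_apply]
      change g x ∈ A
      rw [hx, map_sum]
      refine A.sum_mem fun D _ => ?_
      rw [map_smul]
      exact A.smul_mem (hsingle D) _
  rw [hAg, ← (AlgEquiv.ofInjective g ginj).toLinearEquiv.finrank_eq, Module.finrank_fintype_fun_eq_card,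
    ← Nat.card_eq_fintype_card, Nat.card_coe_set_eq]

/-- For a connected loopless weighted graph, the dimension of `Ψ^{In}_{G,Q}`
equals the number of distinct strongly-connected score vectors. -/
theorem dim_PsiIn_eq_card_strong_score_vectors
    {K : Type*} [Field K] [CharZero K] {n : ℕ} {E : Type*} [Fintype E] [DecidableEq E]
    (a b : E → Fin n) (q : E → K)
    (hab : ∀ e, a e < b e) (hq : ∀ e, q e ≠ 0) (hconn : IsConnectedGraph a b) :
    Module.finrank K (PsiIn K a b q) =
      Set.ncard {D : Fin n → K | ∃ o : E → Bool,
        (∀ u v : Fin n, Relation.ReflTransGen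
          (fun x y => ∃ e, tail a b o e = x ∧ head a b o e = y) u v) ∧
        D = score K a b q o} := by
  have hset : {D : Fin n → K | ∃ o : E → Bool,
        (∀ u v : Fin n, Relation.ReflTransGen
          (fun x y => ∃ e, tail a b o e = x ∧ head a b o e = y) u v) ∧
        D = score K a b q o} =
      Set.range (fun o : {o : E → Bool // IsStrong a b o} => score K a b q o.1) := by
    ext D
    constructor
    · rintro ⟨o, ho, rfl⟩
      exact ⟨⟨o, ho⟩, rfl⟩
    · rintro ⟨o, rfl⟩
      exact ⟨o.1, o.2, rfl⟩
  rw [hset, ← finrank_adjoin_coords _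
    (fun i => ∑ e ∈ Finset.univ.filter (fun e => b e = i), q e)]
  have hmap : (PsiIn K a b q).map (evPhi a b q hq) =
      Algebra.adjoin K (Set.range fun (i : Fin n) (o : {o : E → Bool // IsStrong a b o}) =>
        score K a b q o.1 i - ∑ e ∈ Finset.univ.filter (fun e => b e = i), q e) := by
    rw [PsiIn, AlgHom.map_adjoin, ← Set.range_comp]
    congr 2
    funext i o
    exact evPhi_XIn a b q hab hq i o
  rw [← hmap]
  exact ((PsiIn K a b q).equivMapOfInjective _ (evPhi_inj a b q hq)).toLinearEquiv.finrank_eq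
end
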